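/- arXiv:1508.02821 — 2 statements merged into one kernel-verified Lean document; each statement's English description precedes it below -/
import Mathlib

section
/- Let n ≥ 1, let A be a positive definite symmetric real n×n matrix, and let η be any symmetric real n×n matrix. Then (tr η)² ≤ (tr A) · tr(η A⁻¹ η). (This is the 'inverse-concavity' inequality used in the proof of the Harnack estimate: with A the second fundamental form, H = tr A and b = A⁻¹, it reads (g^{mq} b^{np} − g^{mn} g^{pq}/H) η_{mn} η_{pq} ≥ 0 for any symmetric tensor η.) -/
open Matrix in
theorem Matrix.PosDef.trace_sub_smul_mul_inv_mul_sub_smul {ι : Type*} [Fintype ι] [DecidableEq ι]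
    {A : Matrix ι ι ℝ} (hA : A.PosDef) (η : Matrix ι ι ℝ) (t : ℝ) :
    ((η - t • A) * A⁻¹ * (η - t • A)).trace =
      A.trace * (t * t) + (-2 * η.trace) * t + (η * A⁻¹ * η).trace := by
  have hdet : IsUnit A.det := A.isUnit_iff_isUnit_det.mp hA.isUnit
  have hexpand : (η - t • A) * A⁻¹ * (η - t • A) =
      η * A⁻¹ * η - t • η - t • η + (t * t) • A := by
    simp only [sub_mul, mul_sub, smul_mul_assoc, mul_smul_comm, mul_nonsing_inv A hdet, one_mul,
      nonsing_inv_mul_cancel_right A η hdet, smul_sub, smul_smul]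
    abel
  rw [hexpand]
  simp only [trace_add, trace_sub, trace_smul, smul_eq_mul]
  ring

/-- **Inverse-concavity inequality.** For a positive definite symmetric real `n × n`
matrix `A` and any symmetric real `n × n` matrix `η`, one has
`(tr η)² ≤ (tr A) · tr (η A⁻¹ η)`. -/
theorem trace_sq_le_trace_mul_trace_inv {n : ℕ} (hn : 1 ≤ n)
    (A η : Matrix (Fin n) (Fin n) ℝ) (hA : A.PosDef) (hη : η.IsSymm) :
    η.trace ^ 2 ≤ A.trace * (η * A⁻¹ * η).trace := by
  have hA_symm : A.IsSymm := by
    simpa [Matrix.IsSymm, Matrix.IsHermitian,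
      Matrix.conjTranspose_eq_transpose_of_trivial] using hA.isHermitian
  have hnonneg (t : ℝ) :
      0 ≤ A.trace * (t * t) + (-2 * η.trace) * t + (η * A⁻¹ * η).trace := by
    have h := (hA.inv.posSemidef.mul_mul_conjTranspose_same (η - t • A)).trace_nonneg
    rwa [Matrix.conjTranspose_eq_transpose_of_trivial, (hη.sub (hA_symm.smul t)).eq,
      hA.trace_sub_smul_mul_inv_mul_sub_smul] at h
  have hdiscrim := discrim_le_zero hnonneg
  rw [discrim] at hdiscrim
  linarith
end

section
/- Let a < b be real numbers and let q : ℝ → ℝ be continuous on [a', b] and differentiable on (a, b] with q′(t) ≥ 2 q(t)² for every t ∈ (a, b]. Then q(t) ≥ −1/(2(t − a)) for every t ∈ (a, b]. (This is the ODE comparison, against the solution q(t) = −1/(2(t−a)) of q′ = 2q² with q → −∞ as t → a⁺, used to conclude the Harnack estimate from the differential inequality ∂_t Q ≥ ΔQ + 2⟨∇Q, ∇H/H⟩ + 2Q² via the maximum principle.) -/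
/-- A function on `(a, b]` whose derivative is at least `2 * q ^ 2` is monotone. -/
lemma riccati_monotoneOn {a b : ℝ} {q q' : ℝ → ℝ}
    (hderiv : ∀ t ∈ Set.Ioc a b, HasDerivWithinAt q (q' t) (Set.Ioc a b) t)
    (hineq : ∀ t ∈ Set.Ioc a b, 2 * q t ^ 2 ≤ q' t) :
    MonotoneOn q (Set.Ioc a b) := by
  refine monotoneOn_of_hasDerivWithinAt_nonneg (convex_Ioc a b)
    (fun t ht => (hderiv t ht).continuousWithinAt)
    (fun t ht => (hderiv t (interior_subset ht)).mono interior_subset) fun t ht => ?_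
  have := hineq t (interior_subset ht)
  nlinarith [sq_nonneg (q t)]

/-- Where `q` is negative, `-1 / q` grows at rate at least `2`. -/
lemma riccati_inv_monotoneOn {q q' : ℝ → ℝ} {s : Set ℝ} (hs : Convex ℝ s)
    (hderiv : ∀ t ∈ s, HasDerivWithinAt q (q' t) s t)
    (hineq : ∀ t ∈ s, 2 * q t ^ 2 ≤ q' t) (hneg : ∀ t ∈ s, q t < 0) :
    MonotoneOn (fun t => -(q t)⁻¹ - 2 * t) s := by
  have hd : ∀ t ∈ s, HasDerivWithinAt (fun t => -(q t)⁻¹ - 2 * t)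
      (-(-q' t / q t ^ 2) - 2 * 1) s t := fun t ht =>
    ((hderiv t ht).fun_inv (hneg t ht).ne).fun_neg.fun_sub ((hasDerivWithinAt_id t s).const_mul 2)
  refine monotoneOn_of_hasDerivWithinAt_nonneg hs (fun t ht => (hd t ht).continuousWithinAt)
    (fun t ht => (hd t (interior_subset ht)).mono interior_subset) fun t ht => ?_
  have hq : 0 < q t ^ 2 := sq_pos_of_neg (hneg t (interior_subset ht))
  have : 2 ≤ q' t / q t ^ 2 := (le_div_iff₀ hq).2 (hineq t (interior_subset ht))
  rw [neg_div, neg_neg]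
  linarith

/-- **ODE comparison for the Riccati inequality.** If `q` is continuous and differentiable
on `(a, b]` with `q′(t) ≥ 2 q(t)²` there, then `q(t) ≥ −1/(2(t − a))` on `(a, b]`. -/
theorem riccati_comparison (a b : ℝ) (hab : a < b) (q q' : ℝ → ℝ)
    (hcont : ContinuousOn q (Set.Ioc a b))
    (hderiv : ∀ t ∈ Set.Ioc a b, HasDerivWithinAt q (q' t) (Set.Ioc a b) t)
    (hineq : ∀ t ∈ Set.Ioc a b, 2 * q t ^ 2 ≤ q' t) :
    ∀ t ∈ Set.Ioc a b, -(1 / (2 * (t - a))) ≤ q t := by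
  intro t ht
  have hpos : 0 < 2 * (t - a) := by linarith [ht.1]
  rcases le_or_gt 0 (q t) with hq | hq
  · exact (neg_nonpos.2 (one_div_pos.2 hpos).le).trans hq
  have hsub : Set.Ioc a t ⊆ Set.Ioc a b := Set.Ioc_subset_Ioc_right ht.2
  have hneg : ∀ s ∈ Set.Ioc a t, q s < 0 := fun s hs =>
    (riccati_monotoneOn hderiv hineq (hsub hs) ht hs.2).trans_lt hq
  have hmono := riccati_inv_monotoneOn (convex_Ioc a t)
    (fun s hs => (hderiv s (hsub hs)).mono hsub) (fun s hs => hineq s (hsub hs)) hneg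
  have hbound : t - -(q t)⁻¹ / 2 ≤ a := by
    refine le_of_forall_gt_imp_ge_of_dense fun s hs => ?_
    have hqt : (q t)⁻¹ < 0 := inv_lt_zero.2 hq
    rcases le_or_gt s t with hst | hst
    · have hle : -(q s)⁻¹ - 2 * s ≤ -(q t)⁻¹ - 2 * t := hmono ⟨hs, hst⟩ ⟨ht.1, le_rfl⟩ hst
      have hqs : (q s)⁻¹ < 0 := inv_lt_zero.2 (hneg s ⟨hs, hst⟩)
      linarith
    · linarith
  have hle : 2 * (t - a) ≤ (-q t)⁻¹ := by
    rw [inv_neg]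
    linarith
  have hinv : -q t ≤ (2 * (t - a))⁻¹ := (le_inv_comm₀ hpos (neg_pos.2 hq)).1 hle
  rw [one_div]
  linarith
end
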